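/- arXiv:1411.2889 — 2 statements merged into one kernel-verified Lean document; each statement's English description precedes it below -/
import Mathlib

section
/- Let a_1, …, a_k be positive integers and G = GL_{a_1}(ℂ) × ⋯ × GL_{a_k}(ℂ). Let C be a subgroup of the center of G, let Ḡ = G/C, and let K be a finite subgroup of Ḡ. Then there exists a subgroup K' of K with index [K : K'] bounded above by a constant depending only on a_1, …, a_k, such that the inverse image of K' in G under the quotient map G → G/C is commutative. -/
/- Statement 4: a Jordan-type lemma for finite subgroups of quotients of products of
general linear groups by central subgroups. -/

noncomputable section

open Matrix

namespace Paper

lemma opNorm_le_one_of_inner_map_map {E : Type*} [NormedAddCommGroup E] [InnerProductSpace ℂ E]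
    {A : E →L[ℂ] E} (hA : ∀ v w, inner ℂ (A v) (A w) = inner ℂ v w) : ‖A‖ ≤ 1 :=
  ContinuousLinearMap.opNorm_le_bound _ zero_le_one fun v => by
    rw [one_mul, @norm_eq_sqrt_re_inner ℂ, @norm_eq_sqrt_re_inner ℂ, hA]

/-- An isometric operator with an eigenbasis commutes with an operator `B` at distance less than `1`
from the identity as soon as it commutes with its conjugate `D` by `B`. -/
lemma mul_comm_of_commute_conj {E : Type*} [NormedAddCommGroup E] [InnerProductSpace ℂ E]
    [FiniteDimensional ℂ E] {A B B' D : E →L[ℂ] E}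
    (hA : ∀ v w, inner ℂ (A v) (A w) = inner ℂ v w)
    (hss : ⨆ μ, Module.End.eigenspace (A : E →ₗ[ℂ] E) μ = ⊤)
    (hBB' : B * B' = 1) (hB'B : B' * B = 1) (hD : D * B = B * A) (hAD : A * D = D * A)
    (hB : ‖B - 1‖ < 1) : A * B = B * A := by
  have hBB'v : ∀ v, B (B' v) = v := fun v => DFunLike.congr_fun hBB' v
  have hB'Bv : ∀ v, B' (B v) = v := fun v => DFunLike.congr_fun hB'B v
  have hDv : ∀ v, D (B v) = B (A v) := fun v => DFunLike.congr_fun hD v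
  have hADv : ∀ v, A (D v) = D (A v) := fun v => DFunLike.congr_fun hAD v
  have horth : ∀ (l m : ℂ) (v w : E), A v = l • v → A w = m • w → l ≠ m → inner ℂ v w = 0 := by
    intro l m v w hv hw hlm
    by_contra hne
    have hv0 : inner ℂ v v ≠ (0 : ℂ) := by
      rw [inner_self_ne_zero]
      rintro rfl
      simp at hne
    have h1 := hA v w
    have h2 := hA v v
    rw [hv, hw, inner_smul_left, inner_smul_right, ← mul_assoc] at h1
    rw [hv, inner_smul_left, inner_smul_right, ← mul_assoc] at h2
    have h1' := mul_right_cancel₀ hne (h1.trans (one_mul _).symm)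
    have h2' := mul_right_cancel₀ hv0 (h2.trans (one_mul _).symm)
    have hl : (starRingEnd ℂ) l ≠ 0 := left_ne_zero_of_mul_eq_one h2'
    exact hlm (mul_left_cancel₀ hl (h2'.trans h1'.symm))
  have hpres : ∀ l : ℂ, ∀ w, A w = l • w → A (B w) = l • B w := by
    intro l w hw
    set W := Module.End.eigenspace (D : E →ₗ[ℂ] E) l with hW
    have hinv : ∀ x ∈ W, (A : E →ₗ[ℂ] E) x ∈ W := by
      intro x hx
      rw [hW, Module.End.mem_eigenspace_iff] at hx ⊢
      have hx' : D x = l • x := hx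
      change D (A x) = l • A x
      rw [← hADv, hx', map_smul]
    have hdec := Submodule.inf_iSup_genEigenspace hinv 1
    have hss' : ⨆ μ, (Module.End.genEigenspace (A : E →ₗ[ℂ] E) μ) 1 = ⊤ := hss
    rw [hss', inf_top_eq] at hdec
    have hle : W ≤ Module.End.eigenspace (A : E →ₗ[ℂ] E) l := by
      rw [hdec]
      refine iSup_le fun m => ?_
      by_cases hml : l = m
      · subst hml; exact inf_le_right
      · rintro v ⟨hv1, hv2⟩
        have hv1' : D v = l • v := Module.End.mem_eigenspace_iff.mp hv1
        have hv2' : A v = m • v := Module.End.mem_eigenspace_iff.mp hv2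
        have hu : A (B' v) = l • B' v := by
          have := hDv (B' v)
          rw [hBB'v, hv1'] at this
          rw [← hB'Bv (A (B' v)), ← this, map_smul]
        have ho := horth l m _ _ hu hv2' hml
        have hn : ‖(B - 1) (B' v)‖ ≤ ‖B - 1‖ * ‖B' v‖ := (B - 1).le_opNorm _
        have he : (B - 1) (B' v) = v - B' v := by
          simp [hBB'v]
        rw [he] at hn
        have hpy := norm_sub_sq (𝕜 := ℂ) v (B' v)
        rw [inner_eq_zero_symm.mp ho, map_zero, mul_zero, sub_zero] at hpy
        have hz : B' v = 0 := by
          by_contra hne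
          have hpos : 0 < ‖B' v‖ := norm_pos_iff.mpr hne
          have : ‖v - B' v‖ < ‖B' v‖ := lt_of_le_of_lt hn (by nlinarith)
          nlinarith [norm_nonneg v, norm_nonneg (v - B' v)]
        have : v = 0 := by rw [← hBB'v v, hz, map_zero]
        rw [this]; exact Submodule.zero_mem _
    have hmem : B w ∈ W := by
      rw [hW, Module.End.mem_eigenspace_iff]
      change D (B w) = l • B w
      rw [hDv, hw, map_smul]
    exact Module.End.mem_eigenspace_iff.mp (hle hmem)
  ext v
  have hv : v ∈ ⨆ μ, Module.End.eigenspace (A : E →ₗ[ℂ] E) μ := hss ▸ Submodule.mem_top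
  change A (B v) = B (A v)
  induction hv using Submodule.iSup_induction' with
  | mem l w hw =>
    have hw' : A w = l • w := Module.End.mem_eigenspace_iff.mp hw
    rw [hpres l w hw', hw', map_smul]
  | zero => simp
  | add x y _ _ hx hy => simp only [map_add, hx, hy]

/-- An endomorphism of finite order of a complex vector space is diagonalizable. -/
lemma iSup_eigenspace_eq_top_of_pow_eq_one {E : Type*} [AddCommGroup E] [Module ℂ E]
    [FiniteDimensional ℂ E] {f : Module.End ℂ E} {m : ℕ} (hm : m ≠ 0) (hf : f ^ m = 1) :
    ⨆ μ, f.eigenspace μ = ⊤ := by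
  have hs : f.IsSemisimple :=
    Module.End.isSemisimple_of_squarefree_aeval_eq_zero (p := (Polynomial.X ^ m - 1))
      (Polynomial.X_pow_sub_one_separable_iff.mpr (by exact_mod_cast hm)).squarefree (by simp [hf])
  rw [← hs.iSup_maxGenEigenspace_eq_top_iff]
  exact Module.End.iSup_maxGenEigenspace_eq_top f

/-- In a finite group of linear isometries, the elements at distance less than `1 / 2` from the
identity commute pairwise. -/
lemma mul_comm_of_norm_sub_one_lt {E : Type*} [NormedAddCommGroup E] [InnerProductSpace ℂ E]
    [FiniteDimensional ℂ E] {Γ : Type*} [Group Γ] [Finite Γ] (ρ : Γ →* (E →L[ℂ] E))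
    (hinj : Function.Injective ρ) (hρ : ∀ g v w, inner ℂ (ρ g v) (ρ g w) = inner ℂ v w)
    {a b : Γ} (ha : ‖ρ a - 1‖ < 1 / 2) (hb : ‖ρ b - 1‖ < 1 / 2) : a * b = b * a := by
  by_contra hab
  obtain ⟨b, ⟨hb, hab⟩, hmin⟩ := Set.exists_min_image
    {b : Γ | ‖ρ b - 1‖ < 1 / 2 ∧ a * b ≠ b * a} (fun b => ‖ρ b - 1‖) (Set.toFinite _)
    ⟨b, hb, hab⟩
  have hnorm : ∀ g, ‖ρ g‖ ≤ 1 := fun g => opNorm_le_one_of_inner_map_map (hρ g)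
  have hpos : 0 < ‖ρ b - 1‖ := by
    rw [norm_pos_iff, sub_ne_zero]
    intro h
    rw [hinj (h.trans (map_one ρ).symm)] at hab
    simp at hab
  have hcomm : ‖ρ (a * b * a⁻¹ * b⁻¹) - 1‖ < ‖ρ b - 1‖ := by
    have h1 : ρ (a * b * a⁻¹ * b⁻¹) - 1 =
        ((ρ a - 1) * (ρ b - 1) - (ρ b - 1) * (ρ a - 1)) * ρ (a⁻¹ * b⁻¹) := by
      have h2 : (ρ a - 1) * (ρ b - 1) - (ρ b - 1) * (ρ a - 1) = ρ (a * b) - ρ (b * a) := by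
        rw [map_mul, map_mul]; noncomm_ring
      rw [h2, sub_mul, ← map_mul, ← map_mul, ← map_one ρ]
      congr 2 <;> group
    calc ‖ρ (a * b * a⁻¹ * b⁻¹) - 1‖
        ≤ ‖(ρ a - 1) * (ρ b - 1) - (ρ b - 1) * (ρ a - 1)‖ * ‖ρ (a⁻¹ * b⁻¹)‖ := by
          rw [h1]; exact norm_mul_le _ _
      _ ≤ ‖(ρ a - 1) * (ρ b - 1) - (ρ b - 1) * (ρ a - 1)‖ :=
          mul_le_of_le_one_right (norm_nonneg _) (hnorm _)
      _ ≤ ‖(ρ a - 1) * (ρ b - 1)‖ + ‖(ρ b - 1) * (ρ a - 1)‖ := norm_sub_le _ _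
      _ ≤ ‖ρ a - 1‖ * ‖ρ b - 1‖ + ‖ρ b - 1‖ * ‖ρ a - 1‖ :=
          add_le_add (norm_mul_le _ _) (norm_mul_le _ _)
      _ < ‖ρ b - 1‖ := by nlinarith
  have hc : a * (a * b * a⁻¹ * b⁻¹) = a * b * a⁻¹ * b⁻¹ * a := by
    by_contra hne
    exact absurd (hmin _ ⟨hcomm.trans hb, hne⟩) (not_le.mpr hcomm)
  have hconj : a * (b * a * b⁻¹) = b * a * b⁻¹ * a := by
    have h1 : Commute a (a * b * a⁻¹ * b⁻¹) := hc
    have h2 : Commute a (b * a * b⁻¹) := by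
      have h3 : b * a * b⁻¹ = (a * b * a⁻¹ * b⁻¹)⁻¹ * a := by group
      rw [h3]
      exact h1.inv_right.mul_right (Commute.refl a)
    exact h2
  refine hab (hinj ?_)
  rw [map_mul, map_mul]
  refine mul_comm_of_commute_conj (B' := ρ b⁻¹) (D := ρ (b * a * b⁻¹)) (hρ a)
    (iSup_eigenspace_eq_top_of_pow_eq_one (m := Nat.card Γ) Nat.card_pos.ne' ?_)
    ?_ ?_ ?_ ?_ (hb.trans (by norm_num))
  · have h1 : ρ a ^ Nat.card Γ = 1 := by rw [← map_pow, pow_card_eq_one', map_one]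
    rw [← ContinuousLinearMap.toLinearMap_pow, h1]; rfl
  · rw [← map_mul, mul_inv_cancel, map_one]
  · rw [← map_mul, inv_mul_cancel, map_one]
  · rw [← map_mul, ← map_mul, inv_mul_cancel_right]
  · rw [← map_mul, ← map_mul, hconj]

/-- **Jordan's theorem** for finite groups of linear isometries. -/
lemma exists_index_le_of_isometric (E : Type*) [NormedAddCommGroup E] [InnerProductSpace ℂ E]
    [FiniteDimensional ℂ E] :
    ∃ N : ℕ, ∀ (Γ : Type) [Group Γ] [Finite Γ] (ρ : Γ →* (E →L[ℂ] E)),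
      Function.Injective ρ → (∀ g v w, inner ℂ (ρ g v) (ρ g w) = inner ℂ v w) →
      ∃ J : Subgroup Γ, J.index ≤ N ∧ ∀ x ∈ J, ∀ y ∈ J, x * y = y * x := by
  have := FiniteDimensional.proper ℂ (E →L[ℂ] E)
  obtain ⟨t, ht, hcov⟩ := Metric.totallyBounded_iff.mp
    (isCompact_closedBall (0 : E →L[ℂ] E) 1).totallyBounded (1 / 4) (by norm_num)
  have := ht.to_subtype
  refine ⟨Nat.card t, fun Γ _ _ ρ hinj hρ => ?_⟩
  have hnorm : ∀ g, ‖ρ g‖ ≤ 1 := fun g => opNorm_le_one_of_inner_map_map (hρ g)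
  refine ⟨Subgroup.closure {g | ‖ρ g - 1‖ < 1 / 2}, ?_, fun x hx y hy => ?_⟩
  · have hc : ∀ g, ∃ c : t, dist (ρ g) c < 1 / 4 := fun g => by
      have := hcov (show ρ g ∈ Metric.closedBall 0 1 by simpa using hnorm g)
      simpa using this
    choose c hc using hc
    refine Nat.card_le_card_of_injective (fun q : Γ ⧸ _ => c q.out) fun p q hpq => ?_
    rw [← QuotientGroup.out_eq' p, ← QuotientGroup.out_eq' q, QuotientGroup.eq]
    refine Subgroup.subset_closure ?_
    have hpq' : c p.out = c q.out := hpq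
    have hd : dist (ρ q.out) (ρ p.out) < 1 / 2 := by
      have h1 := hc p.out
      have h2 := hc q.out
      rw [hpq'] at h1
      linarith [dist_triangle_right (ρ q.out) (ρ p.out) (c q.out)]
    have he : ρ (p.out⁻¹ * q.out) - 1 = ρ p.out⁻¹ * (ρ q.out - ρ p.out) := by
      rw [mul_sub, ← map_mul, ← map_mul, inv_mul_cancel, map_one]
    rw [Set.mem_ofPred_eq, he]
    rw [dist_eq_norm] at hd
    exact ((norm_mul_le _ _).trans (mul_le_of_le_one_left (norm_nonneg _) (hnorm _))).trans_lt hd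
  · have := Subgroup.isMulCommutative_closure (k := {g | ‖ρ g - 1‖ < 1 / 2})
      fun x hx y hy => mul_comm_of_norm_sub_one_lt ρ hinj hρ hx hy
    exact setLike_mul_comm hx hy

open scoped ComplexOrder MatrixOrder in
/-- Unitarization: a finite group of invertible complex matrices is conjugate to a group of
unitary matrices. -/
lemma exists_conj_mem_unitary {n : ℕ} (H : Subgroup (GL (Fin n) ℂ)) [Finite H] :
    ∃ T : GL (Fin n) ℂ, ∀ h ∈ H,
      (T * h * T⁻¹ : GL (Fin n) ℂ).val ∈ unitary (Matrix (Fin n) (Fin n) ℂ) := by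
  have := Fintype.ofFinite H
  set P : Matrix (Fin n) (Fin n) ℂ := ∑ h : H, star (h : GL (Fin n) ℂ).val * h.1.val with hP
  have hpos : P.PosDef := by
    refine Matrix.posDef_sum ⟨1, Finset.mem_univ _⟩ fun h _ => ?_
    exact Matrix.PosDef.conjTranspose_mul_self _ (Matrix.mulVec_injective_of_isUnit h.1.isUnit)
  have hinv : ∀ h ∈ H, star h.val * P * h.val = P := by
    intro h hh
    rw [hP, Finset.mul_sum, Finset.sum_mul]
    refine Fintype.sum_equiv (Equiv.mulRight (⟨h, hh⟩ : H)) _ _ fun x => ?_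
    simp [mul_assoc]
  obtain ⟨y, hy, hPy⟩ := CStarAlgebra.isStrictlyPositive_iff_eq_star_mul_self.mp
    hpos.isStrictlyPositive
  obtain ⟨T, rfl⟩ := hy
  refine ⟨T, fun h hh => ?_⟩
  have hstar : star (T * h * T⁻¹ : GL (Fin n) ℂ) * (T * h * T⁻¹) = 1 := by
    have h1 : star h * (star T * T) * h = star T * T := by
      ext1
      simpa [hPy] using hinv h hh
    calc star (T * h * T⁻¹) * (T * h * T⁻¹)
        = star T⁻¹ * (star h * (star T * T) * h) * T⁻¹ := by simp only [star_mul, mul_assoc]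
      _ = star (T * T⁻¹) * (T * T⁻¹) := by rw [h1]; simp only [star_mul, mul_assoc]
      _ = 1 := by simp
  refine Unitary.mem_iff.mpr ⟨congrArg Units.val hstar, ?_⟩
  exact congrArg Units.val (mul_eq_one_comm.mp hstar)

/-- **Jordan's theorem** for finite subgroups of `GL n ℂ`. -/
lemma exists_relIndex_le_of_finite (n : ℕ) :
    ∃ N : ℕ, ∀ H : Subgroup (GL (Fin n) ℂ), Finite H →
      ∃ J ≤ H, J.relIndex H ≤ N ∧ ∀ x ∈ J, ∀ y ∈ J, x * y = y * x := by
  obtain ⟨N, hN⟩ := exists_index_le_of_isometric (EuclideanSpace ℂ (Fin n))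
  refine ⟨N, fun H _ => ?_⟩
  obtain ⟨T, hT⟩ := exists_conj_mem_unitary H
  let ρ : H →* (EuclideanSpace ℂ (Fin n) →L[ℂ] EuclideanSpace ℂ (Fin n)) :=
    ((toEuclideanCLM (n := Fin n) (𝕜 := ℂ) : _ →* _).comp (Units.coeHom _)).comp
      ((MulAut.conj T).toMonoidHom.comp H.subtype)
  have hρ_apply : ∀ h : H, ρ h = toEuclideanCLM (n := Fin n) (𝕜 := ℂ) (T * h * T⁻¹).val :=
    fun _ => rfl
  obtain ⟨J, hJ, hcomm⟩ := hN H ρ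
    (((toEuclideanCLM (n := Fin n) (𝕜 := ℂ)).injective.comp Units.val_injective).comp
      ((MulAut.conj T).injective.comp H.subtype_injective))
    (fun h => ContinuousLinearMap.inner_map_map_of_mem_unitary (by
      rw [hρ_apply]
      exact Unitary.map_mem _ (hT h h.2)))
  refine ⟨J.map H.subtype, Subgroup.map_subtype_le J, ?_, ?_⟩
  · rwa [Subgroup.relIndex, Subgroup.subgroupOf,
      Subgroup.comap_map_eq_self_of_injective H.subtype_injective]
  · rintro _ ⟨x, hx, rfl⟩ _ ⟨y, hy, rfl⟩
    rw [← map_mul, hcomm x hx y hy, map_mul]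

/-- The matrices of determinant one in the preimage of a finite subgroup of the projective linear
group form a finite group. -/
lemma finite_comap_inf_ker_det {n : ℕ} (hn : 0 < n)
    (L : Subgroup (GL (Fin n) ℂ ⧸ Subgroup.center (GL (Fin n) ℂ)))
    (hL : (L : Set (GL (Fin n) ℂ ⧸ Subgroup.center (GL (Fin n) ℂ))).Finite) :
    ((L.comap (QuotientGroup.mk' _) ⊓ GeneralLinearGroup.det.ker : Subgroup (GL (Fin n) ℂ)) :
      Set (GL (Fin n) ℂ)).Finite := by
  refine Set.Finite.of_finite_fibers (QuotientGroup.mk' (Subgroup.center (GL (Fin n) ℂ)))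
    (hL.subset ?_) ?_
  · rintro _ ⟨x, hx, rfl⟩
    exact hx.1
  · rintro _ ⟨x, hx, rfl⟩
    have := NeZero.of_pos hn
    have hroots : (rootsOfUnity n ℂ : Set ℂˣ).Finite :=
      Set.finite_coe_iff.mp (inferInstanceAs (Finite (rootsOfUnity n ℂ)))
    refine Set.Finite.subset (hroots.image
      fun u => x * GeneralLinearGroup.scalar (Fin n) u) ?_
    rintro y ⟨hy, hyx⟩
    obtain ⟨z, hz, rfl⟩ := (QuotientGroup.mk'_eq_mk' _).mp (Set.mem_singleton_iff.mp hyx).symm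
    rw [GeneralLinearGroup.center_eq_range_scalar] at hz
    obtain ⟨u, rfl⟩ := hz
    refine ⟨u, ?_, rfl⟩
    have h1 : GeneralLinearGroup.det x = 1 := hx.2
    have h2 : GeneralLinearGroup.det (x * GeneralLinearGroup.scalar (Fin n) u) = 1 := hy.2
    rw [map_mul, h1, one_mul] at h2
    have h3 := congrArg Units.val h2
    rw [SetLike.mem_coe, mem_rootsOfUnity']
    simpa using h3

/-- Every invertible complex matrix is a scalar multiple of one of determinant one. -/
lemma exists_det_eq_one_mul_center {n : ℕ} (hn : 0 < n) (g : GL (Fin n) ℂ) :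
    ∃ z ∈ Subgroup.center (GL (Fin n) ℂ), GeneralLinearGroup.det (g * z) = 1 := by
  obtain ⟨c, hc⟩ := IsAlgClosed.exists_pow_nat_eq (GeneralLinearGroup.det g)⁻¹.val hn
  have hc0 : c ≠ 0 := by
    rintro rfl
    rw [zero_pow hn.ne'] at hc
    exact (Units.ne_zero _) hc.symm
  refine ⟨GeneralLinearGroup.scalar (Fin n) (Units.mk0 c hc0), ?_, ?_⟩
  · rw [GeneralLinearGroup.center_eq_range_scalar]
    exact ⟨_, rfl⟩
  · have h1 : GeneralLinearGroup.det (GeneralLinearGroup.scalar (Fin n) (Units.mk0 c hc0)) =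
        (GeneralLinearGroup.det g)⁻¹ := by
      ext1
      rw [← hc]
      simp
    rw [map_mul, h1, mul_inv_cancel]

/-- A Jordan-type theorem for finite subgroups of the projective linear group, where the abelian
subgroup has abelian preimage in `GL n ℂ`. -/
lemma exists_relIndex_le_of_finite_quotient_center {n : ℕ} (hn : 0 < n) :
    ∃ N : ℕ, ∀ L : Subgroup (GL (Fin n) ℂ ⧸ Subgroup.center (GL (Fin n) ℂ)),
      (L : Set (GL (Fin n) ℂ ⧸ Subgroup.center (GL (Fin n) ℂ))).Finite →
      ∃ A : Subgroup (GL (Fin n) ℂ ⧸ Subgroup.center (GL (Fin n) ℂ)), A.relIndex L ≤ N ∧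
        ∀ x ∈ A.comap (QuotientGroup.mk' _), ∀ y ∈ A.comap (QuotientGroup.mk' _),
          x * y = y * x := by
  obtain ⟨N, hN⟩ := exists_relIndex_le_of_finite n
  refine ⟨N, fun L hL => ?_⟩
  set π := QuotientGroup.mk' (Subgroup.center (GL (Fin n) ℂ))
  set H : Subgroup (GL (Fin n) ℂ) := L.comap π ⊓ GeneralLinearGroup.det.ker with hH
  have hfin : Finite H := (finite_comap_inf_ker_det hn L hL).to_subtype
  obtain ⟨J, -, hJN, hcomm⟩ := hN H hfin
  have hLH : H.map π = L := by
    refine le_antisymm ?_ fun q hq => ?_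
    · rintro _ ⟨x, hx, rfl⟩
      exact hx.1
    · obtain ⟨g, rfl⟩ := QuotientGroup.mk'_surjective _ q
      obtain ⟨z, hz, hdet⟩ := exists_det_eq_one_mul_center hn g
      have hπ : π (g * z) = π g := ((QuotientGroup.mk'_eq_mk' _).mpr ⟨z, hz, rfl⟩).symm
      exact ⟨g * z, ⟨show π (g * z) ∈ L from hπ ▸ hq, hdet⟩, hπ⟩
  refine ⟨J.map π, ?_, ?_⟩
  · rw [← hLH, ← Subgroup.relIndex_comap]
    exact (Subgroup.relIndex_le_of_le_left (Subgroup.le_comap_map π J)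
      (Subgroup.index_ne_zero_of_finite)).trans hJN
  · rintro x ⟨j, hj, hjx⟩ y ⟨i, hi, hiy⟩
    obtain ⟨z, hz, rfl⟩ := (QuotientGroup.mk'_eq_mk' _).mp hjx
    obtain ⟨w, hw, rfl⟩ := (QuotientGroup.mk'_eq_mk' _).mp hiy
    have hz' : ∀ g, Commute g z := Subgroup.mem_center_iff.mp hz
    have hw' : ∀ g, Commute g w := Subgroup.mem_center_iff.mp hw
    have hji : Commute j i := hcomm j hj i hi
    exact ((hji.mul_right (hw' j)).mul_left (hz' _).symm)

theorem stmt_4 (k : ℕ) (a : Fin k → ℕ) (ha : ∀ i, 0 < a i) :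
    ∃ B : ℕ, ∀ (C : Subgroup (∀ i : Fin k, GL (Fin (a i)) ℂ)),
      ∀ hC : C ≤ Subgroup.center (∀ i : Fin k, GL (Fin (a i)) ℂ),
      haveI : C.Normal :=
        ⟨fun n hn g => by
          have hg := Subgroup.mem_center_iff.mp (hC hn) g
          have h2 : g * n * g⁻¹ = n := by rw [hg]; group
          simpa [h2] using hn⟩
      ∀ K : Subgroup ((∀ i : Fin k, GL (Fin (a i)) ℂ) ⧸ C),
        (K : Set ((∀ i : Fin k, GL (Fin (a i)) ℂ) ⧸ C)).Finite →
        ∃ K' : Subgroup ((∀ i : Fin k, GL (Fin (a i)) ℂ) ⧸ C), K' ≤ K ∧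
          (K'.subgroupOf K).index ≤ B ∧
          ∀ x ∈ K'.comap (QuotientGroup.mk' C), ∀ y ∈ K'.comap (QuotientGroup.mk' C),
            x * y = y * x := by
  choose N hN using fun i => exists_relIndex_le_of_finite_quotient_center (ha i)
  refine ⟨∏ i, N i, fun C hC K hK => ?_⟩
  have : C.Normal := ⟨fun n hn g => by
    rwa [Subgroup.mem_center_iff.mp (hC hn) g, mul_inv_cancel_right]⟩
  have hker : ∀ i, C ≤ ((QuotientGroup.mk' (Subgroup.center (GL (Fin (a i)) ℂ))).comp
      (Pi.evalMonoidHom (fun i => GL (Fin (a i)) ℂ) i)).ker := by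
    intro i c hc
    refine (QuotientGroup.eq_one_iff (c i)).mpr (Subgroup.mem_center_iff.mpr fun g => ?_)
    simpa using congrFun (Subgroup.mem_center_iff.mp (hC hc) (Pi.mulSingle i g)) i
  let φ := fun i => QuotientGroup.lift C _ (hker i)
  choose A hAN hA using fun i => hN i (K.map (φ i)) (hK.image _)
  refine ⟨(⨅ i, (A i).comap (φ i)) ⊓ K, inf_le_right, ?_, fun x hx y hy => ?_⟩
  · change Subgroup.relIndex _ K ≤ _
    rw [Subgroup.inf_relIndex_right]
    refine (Subgroup.relIndex_iInf_le _).trans (Finset.prod_le_prod' fun i _ => ?_)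
    rw [Subgroup.relIndex_comap]
    exact hAN i
  · funext i
    exact hA i _ (Subgroup.mem_iInf.mp hx.1 i) _ (Subgroup.mem_iInf.mp hy.1 i)

end Paper
end
end

section
/- Let m ≥ 1, let d_1, …, d_m ≥ 2 be integers, and let C ≥ 0. There exists a constant C' depending only on m, d_1, …, d_m, and C such that for all p, q and all elements x_1, …, x_m ∈ SO(p,q) with x_j of finite order d_j, if for every j each eigenvalue of x_j on ℂ^{p+q} has multiplicity within C of (p+q)/d_j, then |Σ_{j=1}^{m} ( dim 𝔰𝔬(p,q)/d_j − dim 𝔰𝔬(p,q)^{⟨x_j⟩} )| ≤ C'·(p+q), where dim 𝔰𝔬(p,q) = (p+q)(p+q−1)/2 and 𝔰𝔬(p,q)^{⟨x_j⟩} = {X ∈ 𝔰𝔬(p,q) : x_j X x_j^{−1} = X}. -/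
/- Statement 17: error-term estimate for Σ_j ( dim 𝔰𝔬(p,q)/d_j − dim 𝔰𝔬(p,q)^{⟨x_j⟩} ). -/

noncomputable section

open Matrix
open scoped Classical

namespace Paper

/-- The matrix `J = diag(I_p, −I_q)`. -/
def Jmat (p q : ℕ) : Matrix (Fin p ⊕ Fin q) (Fin p ⊕ Fin q) ℝ :=
  Matrix.fromBlocks 1 0 0 (-1)

/-- The indefinite special orthogonal group `SO(p,q)`, as a set of matrices. -/
def SOpq (p q : ℕ) : Set (Matrix (Fin p ⊕ Fin q) (Fin p ⊕ Fin q) ℝ) :=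
  {S | S.det = 1 ∧ Sᵀ * Jmat p q * S = Jmat p q}

/-- The Lie algebra `𝔰𝔬(p,q) = {X : XᵀJ + JX = 0}`, as an ℝ-submodule of matrices. -/
def soLie (p q : ℕ) : Submodule ℝ (Matrix (Fin p ⊕ Fin q) (Fin p ⊕ Fin q) ℝ) where
  carrier := {X | Xᵀ * Jmat p q + Jmat p q * X = 0}
  zero_mem' := by simp
  add_mem' := by
    intro a b ha hb
    simp only [Set.mem_setOf_eq] at *
    have h : (aᵀ * Jmat p q + Jmat p q * a) + (bᵀ * Jmat p q + Jmat p q * b) = 0 := by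
      rw [ha, hb, add_zero]
    rw [transpose_add, add_mul, mul_add, ← h]
    abel
  smul_mem' := by
    intro c a ha
    simp only [Set.mem_setOf_eq] at *
    rw [transpose_smul, smul_mul_assoc, mul_smul_comm, ← smul_add, ha, smul_zero]

/-- The fixed-point subspace of conjugation by `x` on matrices. -/
def conjFixed {p q : ℕ} (x : Matrix (Fin p ⊕ Fin q) (Fin p ⊕ Fin q) ℝ) :
    Submodule ℝ (Matrix (Fin p ⊕ Fin q) (Fin p ⊕ Fin q) ℝ) where
  carrier := {X | x * X * x⁻¹ = X}
  zero_mem' := by simp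
  add_mem' := by
    intro a b ha hb
    simp only [Set.mem_setOf_eq] at *
    rw [mul_add, add_mul, ha, hb]
  smul_mem' := by
    intro c a ha
    simp only [Set.mem_setOf_eq] at *
    rw [mul_smul_comm, smul_mul_assoc, ha]

lemma exists_eigenbasis {V : Type*} [AddCommGroup V] [Module ℂ V] [FiniteDimensional ℂ V]
    {f : Module.End ℂ V} {d : ℕ} (hd : 0 < d) (hf : f ^ d = 1) :
    ∃ (ι : Type) (_ : Fintype ι) (b : Module.Basis ι ℂ V) (μ : ι → ℂ), ∀ i, f (b i) = μ i • b i := by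
  have hss : f.IsSemisimple := by
    have hsep : (Polynomial.X ^ d - 1 : Polynomial ℂ).Separable :=
      Polynomial.X_pow_sub_one_separable_iff.2 (by exact_mod_cast hd.ne')
    exact Module.End.isSemisimple_of_squarefree_aeval_eq_zero hsep.squarefree (by simp [hf])
  have hint : DirectSum.IsInternal f.eigenspace :=
    DirectSum.isInternal_submodule_of_iSupIndep_of_iSup_eq_top f.eigenspaces_iSupIndep
      hss.iSup_eigenspace_eq_top
  let b := hint.collectedBasis fun μ => Module.finBasis ℂ (f.eigenspace μ)
  exact ⟨_, FiniteDimensional.fintypeBasisIndex b, b, Sigma.fst, fun i =>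
    Module.End.mem_eigenspace_iff.1 (hint.collectedBasis_mem _ i)⟩

/-- If `A ^ d = 1`, the trace of `A ^ k` is the `k`-th power sum of the eigenvalues of `A`, which
are `d`-th roots of unity. -/
lemma trace_pow_eq_sum_roots {n : Type*} [Fintype n] [DecidableEq n] {A : Matrix n n ℂ} {d : ℕ}
    (hd : 0 < d) (hA : A ^ d = 1) :
    (∀ k, (A ^ k).trace = (A.charpoly.roots.map (· ^ k)).sum) ∧
      ∀ lam ∈ A.charpoly.roots, lam ^ d = 1 := by
  let f : Module.End ℂ (n → ℂ) := Matrix.toLin' A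
  have hpow (k : ℕ) : Matrix.toLin' (A ^ k) = f ^ k := Matrix.toLin'_pow A k
  have hfd : f ^ d = 1 := by rw [← hpow, hA, Matrix.toLin'_one]; rfl
  obtain ⟨ι, _, b, μ, hb⟩ := exists_eigenbasis hd hfd
  have hbk (k : ℕ) (i) : (f ^ k) (b i) = μ i ^ k • b i := by
    induction k with
    | zero => simp
    | succ k ih => rw [pow_succ', Module.End.mul_apply, ih, map_smul, hb, smul_smul, pow_succ]
  have hdiag (k : ℕ) : LinearMap.toMatrix b b (f ^ k) = Matrix.diagonal fun i => μ i ^ k := by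
    ext i j
    rw [LinearMap.toMatrix_apply, hbk, map_smul, Module.Basis.repr_self]
    obtain rfl | hij := eq_or_ne i j
    · simp
    · simp [Matrix.diagonal_apply_ne _ hij, Finsupp.single_eq_of_ne hij]
  have hroots : A.charpoly.roots = Finset.univ.val.map μ := by
    have h1 : A.charpoly = f.charpoly := (Matrix.charpoly_toLin' A).symm
    have h2 := hdiag 1
    simp only [pow_one] at h2
    rw [h1, ← LinearMap.charpoly_toMatrix f b, h2, Matrix.charpoly_diagonal]
    have h3 := Polynomial.roots_multiset_prod_X_sub_C (Finset.univ.val.map μ)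
    rwa [Multiset.map_map] at h3
  refine ⟨fun k => ?_, fun lam hlam => ?_⟩
  · rw [hroots, ← Matrix.trace_toLin'_eq, hpow, LinearMap.trace_eq_matrix_trace ℂ b, hdiag,
      Matrix.trace_diagonal, Multiset.map_map]
    rfl
  · rw [hroots] at hlam
    obtain ⟨i, -, rfl⟩ := Multiset.mem_map.1 hlam
    have h := hbk d i
    rw [hfd, Module.End.one_apply] at h
    have h' := smul_left_injective ℂ (b.ne_zero i) (by simpa using h.symm : _ = (1 : ℂ) • b i)
    exact h'

lemma sum_nthRootsFinset_pow {d k : ℕ} (hd : 0 < d) (hk : ¬ d ∣ k) :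
    ∑ lam ∈ Polynomial.nthRootsFinset d (1 : ℂ), lam ^ k = 0 := by
  have hζ := Complex.isPrimitiveRoot_exp d hd.ne'
  set ζ := Complex.exp (2 * Real.pi * Complex.I / d)
  have hsum : ∑ i ∈ Finset.range d, (ζ ^ k) ^ i =
      ∑ lam ∈ Polynomial.nthRootsFinset d (1 : ℂ), lam ^ k := by
    refine Finset.sum_nbij (fun i => ζ ^ i) (fun i _ => ?_) ?_ (fun lam hlam => ?_)
      (fun i _ => pow_right_comm _ _ _)
    · rw [Polynomial.mem_nthRootsFinset hd, pow_right_comm, hζ.pow_eq_one, one_pow]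
    · intro i hi j hj h
      exact hζ.pow_inj (Finset.mem_range.1 hi) (Finset.mem_range.1 hj) h
    · have : NeZero d := ⟨hd.ne'⟩
      obtain ⟨i, hi, rfl⟩ :=
        hζ.eq_pow_of_pow_eq_one ((Polynomial.mem_nthRootsFinset hd _).1 hlam)
      exact ⟨i, Finset.mem_coe.2 (Finset.mem_range.2 hi), rfl⟩
  have hne : ζ ^ k ≠ 1 := fun h => hk (hζ.dvd_of_pow_eq_one k h)
  rw [← hsum, geom_sum_eq hne, pow_right_comm, hζ.pow_eq_one, one_pow, sub_self, zero_div]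

lemma norm_sum_map_pow_le_card {R : Multiset ℂ} {d : ℕ} (hd : 0 < d)
    (hR : ∀ lam ∈ R, lam ^ d = 1) (k : ℕ) :
    ‖(R.map (· ^ k)).sum‖ ≤ R.card := by
  refine (norm_multiset_sum_le _).trans ?_
  rw [Multiset.map_map, Multiset.map_congr rfl (g := fun _ => (1 : ℝ))]
  · simp
  · intro lam hlam
    simp [Complex.norm_eq_one_of_pow_eq_one (hR lam hlam) hd.ne']

/-- Nontrivial power sums of an almost equidistributed multiset of roots of unity are bounded. -/
lemma norm_sum_map_pow_le {R : Multiset ℂ} {d : ℕ} (hd : 0 < d) (hR : ∀ lam ∈ R, lam ^ d = 1)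
    {C : ℝ} (hC : 0 ≤ C) (hcount : ∀ lam ∈ R, |(R.count lam : ℝ) - R.card / d| ≤ C)
    {k : ℕ} (hk : ¬ d ∣ k) :
    ‖(R.map (· ^ k)).sum‖ ≤ d ^ 2 * C := by
  have hd1 : (1 : ℝ) ≤ d := by exact_mod_cast hd
  set S := R.toFinset with hS
  have hsub : S ⊆ Polynomial.nthRootsFinset d (1 : ℂ) := fun lam hlam =>
    (Polynomial.mem_nthRootsFinset hd _).2 (hR lam (Multiset.mem_toFinset.1 hlam))
  have hcard : (Polynomial.nthRootsFinset d (1 : ℂ)).card = d :=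
    (Complex.isPrimitiveRoot_exp d hd.ne').card_nthRootsFinset
  by_cases hSd : S = Polynomial.nthRootsFinset d (1 : ℂ)
  · have heq : (R.map (· ^ k)).sum =
        ∑ lam ∈ S, (((R.count lam : ℝ) - R.card / d : ℝ) : ℂ) * lam ^ k := by
      have h0 : ∑ lam ∈ S, ((R.card / d : ℝ) : ℂ) * lam ^ k = 0 := by
        rw [← Finset.mul_sum, hSd, sum_nthRootsFinset_pow hd hk, mul_zero]
      rw [Finset.sum_multiset_map_count, ← sub_zero (Finset.sum _ _), ← h0,
        ← Finset.sum_sub_distrib]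
      refine Finset.sum_congr rfl fun lam _ => ?_
      push_cast
      rw [nsmul_eq_mul, sub_mul]
    have hterm : ∀ lam ∈ S, ‖(((R.count lam : ℝ) - R.card / d : ℝ) : ℂ) * lam ^ k‖ ≤ C := by
      intro lam hlam
      have hmem := Multiset.mem_toFinset.1 hlam
      rw [norm_mul, norm_pow, Complex.norm_eq_one_of_pow_eq_one (hR lam hmem) hd.ne', one_pow,
        mul_one, Complex.norm_real, Real.norm_eq_abs]
      exact hcount lam hmem
    rw [heq]
    refine (norm_sum_le_of_le _ hterm).trans ?_
    rw [Finset.sum_const, nsmul_eq_mul, hSd, hcard]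
    nlinarith [mul_nonneg (mul_nonneg (sub_nonneg.2 hd1) (zero_le_one.trans hd1)) hC]
  · have hlt : S.card + 1 ≤ d := by
      rw [← hcard]
      exact Finset.card_lt_card (hsub.ssubset_of_ne hSd)
    have hlt' : (S.card : ℝ) + 1 ≤ d := by exact_mod_cast hlt
    refine (norm_sum_map_pow_le_card hd hR k).trans ?_
    have hle : (R.card : ℝ) ≤ S.card * (R.card / d + C) := by
      rw [← nsmul_eq_mul, ← Finset.sum_const]
      conv_lhs => rw [← Multiset.toFinset_sum_count_eq R]
      push_cast
      refine Finset.sum_le_sum fun lam hlam => ?_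
      linarith [(abs_le.1 (hcount lam (Multiset.mem_toFinset.1 hlam))).2]
    have hq : (R.card : ℝ) = R.card / d * d := by field_simp
    have hq0 : (0 : ℝ) ≤ R.card / d := by positivity
    set q : ℝ := R.card / d
    have h1 : q ≤ d * C := by
      nlinarith [mul_nonneg (sub_nonneg.2 hlt') hq0, mul_nonneg (sub_nonneg.2 hlt') hC]
    rw [hq]
    nlinarith

section Trace

variable {n : Type*} [Fintype n] [DecidableEq n]

lemma trace_eq_sum_single (T : Matrix n n ℝ →ₗ[ℝ] Matrix n n ℝ) :
    LinearMap.trace ℝ _ T = ∑ a, ∑ b, T (Matrix.single a b 1) a b := by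
  rw [LinearMap.trace_eq_matrix_trace ℝ (Matrix.stdBasis ℝ n n), Matrix.trace,
    Fintype.sum_prod_type]
  refine Finset.sum_congr rfl fun a _ => Finset.sum_congr rfl fun b _ => ?_
  rw [Matrix.diag_apply, LinearMap.toMatrix_apply, Matrix.stdBasis_eq_single]
  rfl

/-- The projection, for an isometry `x` with inverse `y` of the form `J`, of the matrices onto the
`x`-invariant part of the Lie algebra of `J`. -/
def invariantProj (J x y : Matrix n n ℝ) (d : ℕ) : Matrix n n ℝ →ₗ[ℝ] Matrix n n ℝ where
  toFun X := (1 / (2 * d : ℝ)) • ∑ k ∈ Finset.range d, x ^ k * (X - J * Xᵀ * J) * y ^ k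
  map_add' X Y := by
    rw [← smul_add, ← Finset.sum_add_distrib]
    refine congrArg _ ?_
    refine Finset.sum_congr rfl fun k _ => ?_
    rw [transpose_add]
    noncomm_ring
  map_smul' c X := by
    rw [RingHom.id_apply, smul_comm c, Finset.smul_sum (r := c)]
    refine congrArg _ ?_
    refine Finset.sum_congr rfl fun k _ => ?_
    rw [transpose_smul, Matrix.mul_smul, Matrix.smul_mul, ← smul_sub, Matrix.mul_smul,
      Matrix.smul_mul]

variable {J x y : Matrix n n ℝ} {d : ℕ}

lemma transpose_pow_eq (hJ2 : J * J = 1) (hy : y = J * xᵀ * J) (k : ℕ) :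
    (x ^ k)ᵀ = J * y ^ k * J := by
  induction k with
  | zero => simp [hJ2]
  | succ k ih =>
    have hx : xᵀ = J * y * J := by
      rw [hy]; simp only [← mul_assoc, hJ2, one_mul]; simp only [mul_assoc, hJ2, mul_one]
    rw [pow_succ, transpose_mul, ih, hx, pow_succ']
    simp only [mul_assoc]
    rw [← mul_assoc J J, hJ2, one_mul]

lemma trace_invariantProj (hJ2 : J * J = 1) (hJ : Jᵀ = J) (hy : y = J * xᵀ * J) :
    LinearMap.trace ℝ _ (invariantProj J x y d) =
      1 / (2 * d) * ∑ k ∈ Finset.range d, ((x ^ k).trace ^ 2 - (x ^ (2 * k)).trace) := by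
  have htr (k : ℕ) : (y ^ k).trace = (x ^ k).trace := by
    rw [← Matrix.trace_transpose (x ^ k), transpose_pow_eq hJ2 hy, Matrix.trace_mul_comm,
      ← mul_assoc, hJ2, one_mul]
  have hentry (k : ℕ) (a b : n) :
      (x ^ k * (Matrix.single a b (1 : ℝ) - J * (Matrix.single a b (1 : ℝ))ᵀ * J) * y ^ k :
        Matrix n n ℝ) a b = (x ^ k) a a * (y ^ k) b b - (x ^ k * J) a b * (J * x ^ k) b a := by
    have h1 (B D : Matrix n n ℝ) (i j : n) :
        (B * Matrix.single i j (1 : ℝ) * D) a b = B a i * D j b := by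
      simp [Matrix.mul_apply, Matrix.single_apply, ite_and]
    have h2 : (J * x ^ k)ᵀ = J * y ^ k := by
      rw [transpose_mul, hJ, transpose_pow_eq hJ2 hy, mul_assoc _ J J, hJ2, mul_one]
    rw [Matrix.transpose_single, mul_sub, sub_mul, Matrix.sub_apply, h1,
      ← Matrix.transpose_apply (J * x ^ k), h2, ← h1 (x ^ k * J)]
    simp only [mul_assoc]
  have hsq (k : ℕ) : ∑ a, ∑ b, (x ^ k * J) a b * (J * x ^ k) b a = (x ^ (2 * k)).trace := by
    have h : x ^ (2 * k) = x ^ k * J * (J * x ^ k) := by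
      rw [mul_assoc, ← mul_assoc J J, hJ2, one_mul, two_mul, pow_add]
    rw [h]
    simp only [Matrix.trace, Matrix.diag_apply, Matrix.mul_apply (M := x ^ k * J)]
  have hmul (k : ℕ) : ∑ a, ∑ b, (x ^ k) a a * (y ^ k) b b = (x ^ k).trace ^ 2 := by
    rw [sq, ← Finset.sum_mul_sum]
    nth_rw 2 [← htr]
    rfl
  have happ (a b : n) : invariantProj J x y d (Matrix.single a b 1) a b =
      1 / (2 * d) * ∑ k ∈ Finset.range d,
        ((x ^ k) a a * (y ^ k) b b - (x ^ k * J) a b * (J * x ^ k) b a) := by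
    simp only [invariantProj, LinearMap.coe_mk, AddHom.coe_mk, Matrix.smul_apply,
      Matrix.sum_apply, hentry, smul_eq_mul]
  simp only [trace_eq_sum_single, happ, ← Finset.mul_sum]
  congr 1
  rw [Finset.sum_congr rfl fun a _ => Finset.sum_comm, Finset.sum_comm]
  refine Finset.sum_congr rfl fun k _ => ?_
  simp only [Finset.sum_sub_distrib, hsq, hmul]

lemma isProj_invariantProj (hJ2 : J * J = 1) (hJ : Jᵀ = J) (hy : y = J * xᵀ * J)
    (hxy : x * y = 1) (hd : 0 < d) (hx : x ^ d = 1) {W : Submodule ℝ (Matrix n n ℝ)}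
    (hW : ∀ X, X ∈ W ↔ Xᵀ = -(J * X * J) ∧ x * X * y = X) :
    LinearMap.IsProj W (invariantProj J x y d) := by
  have hyx : y * x = 1 := mul_eq_one_comm.1 hxy
  have hyd : y ^ d = 1 := by
    have h := (show Commute x y from hxy.trans hyx.symm).mul_pow d
    rwa [hxy, one_pow, hx, one_mul, eq_comm] at h
  have hd0 : (d : ℝ) ≠ 0 := by exact_mod_cast hd.ne'
  have hyT (k : ℕ) : (y ^ k)ᵀ = J * x ^ k * J := by
    refine transpose_pow_eq hJ2 ?_ k
    rw [hy, transpose_mul, transpose_mul, transpose_transpose, hJ]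
    simp only [← mul_assoc, hJ2, one_mul]
    simp only [mul_assoc, hJ2, mul_one]
  have hxT := transpose_pow_eq (x := x) hJ2 hy
  constructor
  · intro X
    rw [hW]
    simp only [invariantProj, LinearMap.coe_mk, AddHom.coe_mk]
    set Z := X - J * Xᵀ * J with hZ
    have hZT : Zᵀ = -(J * Z * J) := by
      rw [hZ, transpose_sub, transpose_mul, transpose_mul, transpose_transpose, hJ, mul_sub,
        sub_mul]
      simp only [← mul_assoc, hJ2, one_mul]
      simp only [mul_assoc, hJ2, mul_one]
      abel
    constructor
    · rw [transpose_smul, transpose_sum, Matrix.mul_smul, Matrix.smul_mul, ← smul_neg,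
        Finset.mul_sum, Finset.sum_mul, ← Finset.sum_neg_distrib]
      congr 1
      refine Finset.sum_congr rfl fun k _ => ?_
      rw [transpose_mul, transpose_mul, hyT, hxT, hZT]
      have hJJ (B : Matrix n n ℝ) : J * (J * B) = B := by rw [← mul_assoc, hJ2, one_mul]
      simp only [mul_assoc, neg_mul, mul_neg, hJJ]
    · rw [Matrix.mul_smul, Matrix.smul_mul, Finset.mul_sum, Finset.sum_mul]
      congr 1
      have hstep : ∀ k, x * (x ^ k * Z * y ^ k) * y = x ^ (k + 1) * Z * y ^ (k + 1) := by
        intro k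
        rw [pow_succ' x, pow_succ y]
        simp only [mul_assoc]
      simp only [hstep]
      have h1 := Finset.sum_range_succ (fun k => x ^ k * Z * y ^ k) d
      rw [Finset.sum_range_succ', hx, hyd, pow_zero, pow_zero] at h1
      exact add_right_cancel h1
  · intro X hX
    obtain ⟨hX1, hX2⟩ := (hW X).1 hX
    have hfix (k : ℕ) : x ^ k * X * y ^ k = X := by
      induction k with
      | zero => simp
      | succ k ih =>
        rw [pow_succ x, pow_succ' y]
        calc x ^ k * x * X * (y * y ^ k) = x ^ k * (x * X * y) * y ^ k := by
              simp only [mul_assoc]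
          _ = X := by rw [hX2, ih]
    have hZ : X - J * Xᵀ * J = (2 : ℝ) • X := by
      rw [hX1, mul_neg, neg_mul, sub_neg_eq_add]
      simp only [← mul_assoc, hJ2, one_mul]
      simp only [mul_assoc, hJ2, mul_one]
      rw [two_smul]
    simp only [invariantProj, LinearMap.coe_mk, AddHom.coe_mk, hZ, Matrix.mul_smul,
      Matrix.smul_mul, hfix, Finset.sum_const, Finset.card_range]
    rw [← Nat.cast_smul_eq_nsmul ℝ, smul_smul, smul_smul]
    convert one_smul ℝ X using 2
    field_simp

/-- For an element of finite order, the dimension of the invariants in the Lie algebra of `J` is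
the average of the trace of its powers on that Lie algebra. -/
lemma finrank_invariants (hJ2 : J * J = 1) (hJ : Jᵀ = J) (hy : y = J * xᵀ * J)
    (hxy : x * y = 1) (hd : 0 < d) (hx : x ^ d = 1) {W : Submodule ℝ (Matrix n n ℝ)}
    (hW : ∀ X, X ∈ W ↔ Xᵀ = -(J * X * J) ∧ x * X * y = X) :
    (Module.finrank ℝ W : ℝ) =
      1 / (2 * d) * ∑ k ∈ Finset.range d, ((x ^ k).trace ^ 2 - (x ^ (2 * k)).trace) := by
  rw [← trace_invariantProj hJ2 hJ hy, (isProj_invariantProj hJ2 hJ hy hxy hd hx hW).trace]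

lemma abs_finrank_sub_le (hJ2 : J * J = 1) (hJ : Jᵀ = J) (hy : y = J * xᵀ * J)
    (hxy : x * y = 1) (hd : 0 < d) (hx : x ^ d = 1) {W : Submodule ℝ (Matrix n n ℝ)}
    (hW : ∀ X, X ∈ W ↔ Xᵀ = -(J * X * J) ∧ x * X * y = X) {C : ℝ} (hC : 0 ≤ C)
    (hcount : ∀ lam ∈ (x.map (algebraMap ℝ ℂ)).charpoly.roots,
      |((x.map (algebraMap ℝ ℂ)).charpoly.roots.count lam : ℝ) - Fintype.card n / d| ≤ C) :
    |((Fintype.card n : ℝ) * (Fintype.card n - 1) / 2) / d - Module.finrank ℝ W| ≤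
      (d ^ 2 * C + 1) * Fintype.card n := by
  set N : ℝ := (Fintype.card n : ℝ) with hN
  have hN0 : 0 ≤ N := by positivity
  have hd1 : (1 : ℝ) ≤ d := by exact_mod_cast hd
  set A := x.map (algebraMap ℝ ℂ) with hAdef
  have hApow (k : ℕ) : A ^ k = (x ^ k).map (algebraMap ℝ ℂ) :=
    (map_pow (algebraMap ℝ ℂ).mapMatrix x k).symm
  have hA : A ^ d = 1 := by rw [hApow, hx]; exact map_one (algebraMap ℝ ℂ).mapMatrix
  obtain ⟨htr, hroot⟩ := trace_pow_eq_sum_roots hd hA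
  have hnorm (k : ℕ) : ‖(A.charpoly.roots.map (· ^ k)).sum‖ = |(x ^ k).trace| := by
    rw [← htr, hApow, ← AddMonoidHom.map_trace (algebraMap ℝ ℂ)]
    simp
  have hcard : (A.charpoly.roots.card : ℝ) = N := by
    rw [hN, ← Polynomial.Splits.natDegree_eq_card_roots (IsAlgClosed.splits _),
      Matrix.charpoly_natDegree_eq_dim]
  have hall (k : ℕ) : |(x ^ k).trace| ≤ N := by
    rw [← hnorm, ← hcard]
    exact norm_sum_map_pow_le_card hd hroot k
  have hsmall {k : ℕ} (hk : ¬ d ∣ k) : |(x ^ k).trace| ≤ d ^ 2 * C := by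
    rw [← hnorm]
    exact norm_sum_map_pow_le hd hroot hC (by simpa only [hcard] using hcount) hk
  have hterm (k : ℕ) (hk : k ∈ Finset.range d) :
      |((x ^ k).trace ^ 2 - (x ^ (2 * k)).trace) - if k = 0 then N ^ 2 else 0| ≤
        (d ^ 2 * C + 1) * N := by
    have h2 := abs_le.1 (hall (2 * k))
    split_ifs with h0
    · have hDC : 0 ≤ d ^ 2 * C * N := by positivity
      subst h0
      rw [pow_zero, Matrix.trace_one, ← hN, abs_le]
      constructor <;> linarith
    · have hnd : ¬ d ∣ k := Nat.not_dvd_of_pos_of_lt (Nat.pos_of_ne_zero h0) (Finset.mem_range.1 hk)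
      have hs : (x ^ k).trace ^ 2 ≤ d ^ 2 * C * N := by
        rw [← sq_abs, sq]
        exact mul_le_mul (hsmall hnd) (hall k) (abs_nonneg _) (by positivity)
      have hs0 := sq_nonneg (x ^ k).trace
      rw [sub_zero, abs_le]
      constructor <;> linarith
  have hsum := Finset.abs_sum_le_sum_abs
    (fun k => ((x ^ k).trace ^ 2 - (x ^ (2 * k)).trace) - if k = 0 then N ^ 2 else 0)
    (Finset.range d)
  replace hsum := hsum.trans (Finset.sum_le_sum hterm)
  rw [Finset.sum_sub_distrib, Finset.sum_ite_eq' (Finset.range d) 0,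
    if_pos (Finset.mem_range.2 hd), Finset.sum_const, Finset.card_range, nsmul_eq_mul] at hsum
  rw [finrank_invariants hJ2 hJ hy hxy hd hx hW]
  set S := ∑ k ∈ Finset.range d, ((x ^ k).trace ^ 2 - (x ^ (2 * k)).trace)
  have heq : N * (N - 1) / 2 / d - 1 / (2 * d) * S = -((S - N ^ 2) + N) / (2 * d) := by
    field_simp
    ring
  rw [heq, abs_div, abs_neg, abs_of_pos (by positivity : (0 : ℝ) < 2 * d),
    div_le_iff₀ (by positivity)]
  refine (abs_add_le _ _).trans ?_
  rw [abs_of_nonneg hN0]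
  have hDC : 0 ≤ d ^ 2 * C * N * d := by positivity
  nlinarith [mul_nonneg (sub_nonneg.2 hd1) hN0]

end Trace

lemma Jmat_mul_self (p q : ℕ) : Jmat p q * Jmat p q = 1 := by
  simp [Jmat, Matrix.fromBlocks_multiply]

lemma transpose_Jmat (p q : ℕ) : (Jmat p q)ᵀ = Jmat p q := by
  simp [Jmat, Matrix.fromBlocks_transpose]

lemma mem_soLie_iff {p q : ℕ} {X : Matrix (Fin p ⊕ Fin q) (Fin p ⊕ Fin q) ℝ} :
    X ∈ soLie p q ↔ Xᵀ = -(Jmat p q * X * Jmat p q) := by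
  change Xᵀ * Jmat p q + Jmat p q * X = 0 ↔ _
  rw [add_eq_zero_iff_eq_neg]
  constructor <;> intro h
  · rw [← neg_mul, ← h, mul_assoc, Jmat_mul_self, mul_one]
  · rw [h, neg_mul, mul_assoc, Jmat_mul_self, mul_one]

theorem stmt_17 (m : ℕ) (hm : 1 ≤ m) (d : Fin m → ℕ) (hd : ∀ j, 2 ≤ d j)
    (C : ℝ) (hC : 0 ≤ C) :
    ∃ C' : ℝ, ∀ p q : ℕ,
      ∀ x : Fin m → Matrix (Fin p ⊕ Fin q) (Fin p ⊕ Fin q) ℝ,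
      (∀ j, x j ∈ SOpq p q) →
      (∀ j, orderOf (x j) = d j) →
      -- each eigenvalue of x_j on ℂ^{p+q} has multiplicity within C of (p+q)/d_j
      (∀ j, ∀ lam ∈ ((x j).map (algebraMap ℝ ℂ)).charpoly.roots,
        |((((x j).map (algebraMap ℝ ℂ)).charpoly.roots.count lam : ℝ)) -
          ((p : ℝ) + q) / (d j)| ≤ C) →
      |∑ j, ((((p : ℝ) + q) * ((p : ℝ) + q - 1) / 2) / (d j) -
          (Module.finrank ℝ (soLie p q ⊓ conjFixed (x j) :
            Submodule ℝ (Matrix (Fin p ⊕ Fin q) (Fin p ⊕ Fin q) ℝ)) : ℝ))| ≤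
        C' * ((p : ℝ) + q) := by
  refine ⟨∑ j, ((d j : ℝ) ^ 2 * C + 1), fun p q x hSO hord hcount => ?_⟩
  have hcardN : ((Fintype.card (Fin p ⊕ Fin q) : ℕ) : ℝ) = (p : ℝ) + q := by simp
  rw [Finset.sum_mul]
  refine (Finset.abs_sum_le_sum_abs _ _).trans (Finset.sum_le_sum fun j _ => ?_)
  have hJ2 := Jmat_mul_self p q
  have hyx : Jmat p q * (x j)ᵀ * Jmat p q * x j = 1 := by
    rw [mul_assoc, mul_assoc, ← mul_assoc (x j)ᵀ, (hSO j).2, hJ2]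
  have hinv : (x j)⁻¹ = Jmat p q * (x j)ᵀ * Jmat p q := Matrix.inv_eq_left_inv hyx
  have hpow : x j ^ d j = 1 := hord j ▸ pow_orderOf_eq_one (x j)
  rw [← hcardN]
  refine abs_finrank_sub_le hJ2 (transpose_Jmat p q) rfl (mul_eq_one_comm.1 hyx)
    (zero_lt_two.trans_le (hd j)) hpow (fun X => ?_) hC (by simpa only [hcardN] using hcount j)
  rw [Submodule.mem_inf, mem_soLie_iff, ← hinv]
  rfl


end Paper
end
end
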